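/- (DualDA coincides with Representer Points attribution under the multiclass hinge loss.) Fix a training index i, a weight configuration W = (w_c)_{c∈[K]}, and dual variables α = (α_{ic}) with ∑_{c=1}^K α_{ic} = C. Let c* := argmax_{c∈[K]} (1 − δ_{c,y_i} − ⟨w_{y_i}, f_i⟩ + ⟨w_c, f_i⟩) and assume this maximizer is unique. Assume complementary slackness in the following form: if c* = y_i then α_{ic} = 0 for all c ≠ y_i, and if c* ≠ y_i then α_{ic} = 0 for all c ≠ c*. Then for every class c ∈ [K] and every test feature f_test ∈ ℝ^d, the DualDA attribution τ_c(f_test, i) = λ_{ic}⟨f_i, f_test⟩ equals the case formula: C·⟨f_i, f_test⟩ if c = y_i ≠ c*; −C·⟨f_i, f_test⟩ if c = c* ≠ y_i; and 0 if c = y_i = c* or c ∉ {y_i, c*}. In particular τ_c(f_test, i) equals the Representer Points attribution of sample i computed with the multiclass hinge loss. -/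

import Mathlib

open Finset RealInnerProductSpace

/-- DualDA coefficient `λ_{ic}`: `C − α_{i,y_i}` if `c = y_i`, `−α_{ic}` otherwise. -/
def dualDACoeff {N K : ℕ} (y : Fin N → Fin K) (C : ℝ)
    (α : Fin N → Fin K → ℝ) (i : Fin N) (c : Fin K) : ℝ :=
  if c = y i then C - α i (y i) else -α i c

/-- DualDA attribution `τ_c(f, i) = λ_{ic} ⟨f_i, f⟩`. -/
noncomputable def dualDA {N K d : ℕ} (f : Fin N → EuclideanSpace ℝ (Fin d))
    (y : Fin N → Fin K) (C : ℝ) (α : Fin N → Fin K → ℝ)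
    (c : Fin K) (ftest : EuclideanSpace ℝ (Fin d)) (i : Fin N) : ℝ :=
  dualDACoeff y C α i c * ⟪f i, ftest⟫

/-- The multiclass hinge loss of a score vector `β : Fin K → ℝ` for a sample with
label `yi`: `C · max_{k∈[K]} (1 − δ_{k,yi} − β_{yi} + β_k)`. -/
noncomputable def hingeLoss {K : ℕ} (hK : 0 < K) (C : ℝ) (yi : Fin K)
    (β : Fin K → ℝ) : ℝ :=
  C * Finset.univ.sup' ⟨⟨0, hK⟩, Finset.mem_univ _⟩
    (fun k => 1 - (if k = yi then (1:ℝ) else 0) - β yi + β k)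

/-- Hinge Representer attribution
`τ^{HingeRP}_c(f_test, i) := −(∂/∂β_c)[hinge loss](β̂)·⟨f_i, f_test⟩`. -/
noncomputable def hingeRP {K d : ℕ} (hK : 0 < K) (C : ℝ) (yi : Fin K)
    (fi : EuclideanSpace ℝ (Fin d)) (βhat : Fin K → ℝ) (c : Fin K)
    (ftest : EuclideanSpace ℝ (Fin d)) : ℝ :=
  -(deriv (fun t : ℝ => hingeLoss hK C yi (Function.update βhat c t)) (βhat c))
    * ⟪fi, ftest⟫

/-- Where the maximal margin is attained at a single class `m`, the hinge loss has partial
derivatives `C · (δ_{c,m} − δ_{c,yi})`. -/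
theorem hasDerivAt_hingeLoss_update {K : ℕ} (hK : 0 < K) (C : ℝ) (yi m : Fin K) (β : Fin K → ℝ)
    (hmax : ∀ k, k ≠ m →
      1 - (if k = yi then (1:ℝ) else 0) - β yi + β k
        < 1 - (if m = yi then (1:ℝ) else 0) - β yi + β m) (c : Fin K) :
    HasDerivAt (fun t : ℝ => hingeLoss hK C yi (Function.update β c t))
      (C * ((if c = m then 1 else 0) - (if c = yi then 1 else 0))) (β c) := by
  let g : Fin K → ℝ → ℝ := fun k t =>
    1 - (if k = yi then (1:ℝ) else 0) - Function.update β c t yi + Function.update β c t k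
  have hcoord (k : Fin K) :
      HasDerivAt (fun t : ℝ => Function.update β c t k) (if c = k then 1 else 0) (β c) := by
    rcases eq_or_ne c k with rfl | h
    · simpa using hasDerivAt_id' (β c)
    · simpa [Function.update_of_ne h.symm, h] using hasDerivAt_const (β c) (β k)
  have hg (k : Fin K) :
      HasDerivAt (g k) ((if c = k then 1 else 0) - (if c = yi then 1 else 0)) (β c) := by
    exact (((hcoord yi).const_sub (1 - (if k = yi then (1:ℝ) else 0))).add (hcoord k)).congr_deriv
      (by ring)
  have hle : ∀ᶠ t in nhds (β c), ∀ k, g k t ≤ g m t := by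
    refine Filter.eventually_all.2 fun k => ?_
    rcases eq_or_ne k m with rfl | h
    · exact Filter.Eventually.of_forall fun _ => le_rfl
    · have hlt : g k (β c) < g m (β c) := by simpa [g] using hmax k h
      exact ((hg k).continuousAt.eventually_lt (hg m).continuousAt hlt).mono fun _ => le_of_lt
  refine ((hg m).const_mul C).congr_of_eventuallyEq (hle.mono fun t ht => ?_)
  exact congrArg (C * ·) (le_antisymm (Finset.sup'_le _ _ fun k _ => ht k)
    (Finset.le_sup' (fun k => g k t) (Finset.mem_univ m)))

/-- Under complementary slackness at the class `m`, the DualDA coefficient is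
`C · (δ_{c,y_i} − δ_{c,m})`. -/
theorem dualDACoeff_eq_of_slackness {N K : ℕ} (y : Fin N → Fin K) (C : ℝ)
    (α : Fin N → Fin K → ℝ) (i : Fin N) (hsum : ∑ c, α i c = C) (m : Fin K)
    (hα : ∀ c, c ≠ m → α i c = 0) (c : Fin K) :
    dualDACoeff y C α i c = C * ((if c = y i then 1 else 0) - (if c = m then 1 else 0)) := by
  have hm : α i m = C := by
    rw [← hsum, Finset.sum_eq_single m (fun c _ h => hα c h) (by simp)]
  have hval (k : Fin K) : α i k = if k = m then C else 0 := by
    split_ifs with h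
    · rw [h, hm]
    · exact hα k h
  unfold dualDACoeff
  rw [hval, hval]
  split_ifs <;> simp_all

theorem stmt11 (N K d : ℕ) (hK : 0 < K)
    (f : Fin N → EuclideanSpace ℝ (Fin d)) (y : Fin N → Fin K)
    (C : ℝ) (hC : 0 < C)
    (i : Fin N) (W : Fin K → EuclideanSpace ℝ (Fin d))
    (α : Fin N → Fin K → ℝ)
    (hsum : ∑ c, α i c = C)
    (cstar : Fin K)
    (hmax : ∀ c : Fin K, c ≠ cstar →
      1 - (if c = y i then (1:ℝ) else 0) - ⟪W (y i), f i⟫ + ⟪W c, f i⟫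
        < 1 - (if cstar = y i then (1:ℝ) else 0) - ⟪W (y i), f i⟫ + ⟪W cstar, f i⟫)
    (hcs1 : cstar = y i → ∀ c : Fin K, c ≠ y i → α i c = 0)
    (hcs2 : cstar ≠ y i → ∀ c : Fin K, c ≠ cstar → α i c = 0) :
    ∀ (c : Fin K) (ftest : EuclideanSpace ℝ (Fin d)),
      ((c = y i → y i ≠ cstar →
          dualDA f y C α c ftest i = C * ⟪f i, ftest⟫)
        ∧ (c = cstar → cstar ≠ y i →
            dualDA f y C α c ftest i = -(C * ⟪f i, ftest⟫))
        ∧ ((c = y i ∧ y i = cstar) ∨ (c ≠ y i ∧ c ≠ cstar) →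
            dualDA f y C α c ftest i = 0))
      ∧ dualDA f y C α c ftest i
          = hingeRP hK C (y i) (f i) (fun k => ⟪W k, f i⟫) c ftest := by
  have hα : ∀ c, c ≠ cstar → α i c = 0 := by
    by_cases h : cstar = y i
    · simpa only [h] using hcs1 h
    · exact hcs2 h
  intro c ftest
  have hder := (hasDerivAt_hingeLoss_update hK C (y i) cstar (fun k => ⟪W k, f i⟫) hmax c).deriv
  have hcoeff := dualDACoeff_eq_of_slackness y C α i hsum cstar hα c
  unfold dualDA hingeRP
  rw [hcoeff, hder]
  refine ⟨⟨?_, ?_, ?_⟩, by ring⟩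
  · rintro rfl h
    simp [h]
  · rintro rfl h
    simp [h]
  · rintro (⟨rfl, h⟩ | ⟨h₁, h₂⟩)
    · simp [h]
    · simp [h₁, h₂]
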